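/- (Theorem: primitive recursive indices to primitive recursive local codes.) There is a partial recursive function φ : ℕ ⇀ ℕ such that if a ∈ I_prec then φ(a) is defined, φ(a) ∈ C_prec, and End(⟨a⟩(⟨⟩)) = End(φ(a)). -/

import Mathlib

namespace Shoen

/-- Kleene application: value of the `e`-th partial recursive function at `n`,
in the standard numbering via `Nat.Partrec.Code`. -/
def peval (e n : ℕ) : Part ℕ := (Denumerable.ofNat Nat.Partrec.Code e).eval n

/-- `e` is an index of a (total) primitive recursive function. -/
def PrimIndex (e : ℕ) : Prop := ∃ f : ℕ → ℕ, Nat.Primrec f ∧ ∀ n, peval e n = Part.some (f n)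

/-- Kleene's relation `<_O`. -/
inductive KLt : ℕ → ℕ → Prop
  | base : KLt 1 2
  | step {a b : ℕ} : KLt a b → KLt b (2 ^ b)
  | lim {e : ℕ} (h : ∀ n, (peval e n).Dom)
      (hm : ∀ n, KLt ((peval e n).get (h n)) ((peval e (n + 1)).get (h (n + 1))))
      (n : ℕ) : KLt ((peval e n).get (h n)) (3 * 5 ^ e)
  | trans {a b c : ℕ} : KLt a b → KLt b c → KLt a c

/-- Kleene's `O`. -/
def KO (a : ℕ) : Prop := KLt a (2 ^ a)

/-- The auxiliary relation `<'_O`. -/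
inductive KLt' : ℕ → ℕ → Prop
  | base : KLt' 1 2
  | step {a b : ℕ} : KLt' a b → KLt' b (2 ^ b)
  | lim {e n x : ℕ} : x ∈ peval e n → KLt' x (3 * 5 ^ e)
  | trans {a b c : ℕ} : KLt' a b → KLt' b c → KLt' a c

/-- The inductive characterization `O'` of Kleene's `O`. -/
inductive KO' : ℕ → Prop
  | one : KO' 1
  | step {a : ℕ} : KO' a → KO' (2 ^ a)
  | lim {e : ℕ} (h : ∀ n, (peval e n).Dom)
      (hm : ∀ n, KLt' ((peval e n).get (h n)) ((peval e (n + 1)).get (h (n + 1)))) :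
      KO' (3 * 5 ^ e)



/-! ### Syntax of first order arithmetic (negation normal form) -/

/-- Terms of the language `0,1,+,×,=`, with de Bruijn variables. -/
inductive Trm : Type
  | var : ℕ → Trm
  | zero : Trm
  | one : Trm
  | add : Trm → Trm → Trm
  | mul : Trm → Trm → Trm
deriving DecidableEq

/-- Formulas in negation normal form: literals (atomic and negated atomic
formulas) combined by `∧, ∨, ∀, ∃` (de Bruijn binders). -/
inductive Fml : Type
  | eq : Trm → Trm → Fml
  | ne : Trm → Trm → Fml
  | and : Fml → Fml → Fml
  | or : Fml → Fml → Fml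
  | all : Fml → Fml
  | ex : Fml → Fml
deriving DecidableEq

/-- All free variables of a term are `< k`. -/
def Trm.cu : Trm → ℕ → Bool
  | .var i, k => decide (i < k)
  | .zero, _ => true
  | .one, _ => true
  | .add s t, k => s.cu k && t.cu k
  | .mul s t, k => s.cu k && t.cu k

/-- All free variables of a formula are `< k`. -/
def Fml.cu : Fml → ℕ → Bool
  | .eq s t, k => s.cu k && t.cu k
  | .ne s t, k => s.cu k && t.cu k
  | .and A B, k => A.cu k && B.cu k
  | .or A B, k => A.cu k && B.cu k
  | .all A, k => A.cu (k + 1)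
  | .ex A, k => A.cu (k + 1)

/-- A sentence is a closed formula. -/
abbrev Sentence : Type := { A : Fml // A.cu 0 = true }

/-- Value of a term under an environment. -/
def Trm.val (ρ : ℕ → ℕ) : Trm → ℕ
  | .var i => ρ i
  | .zero => 0
  | .one => 1
  | .add s t => s.val ρ + t.val ρ
  | .mul s t => s.val ρ * t.val ρ

/-- Extend an environment by a value for variable `0`. -/
def consEnv (n : ℕ) (ρ : ℕ → ℕ) : ℕ → ℕ
  | 0 => n
  | k + 1 => ρ k

/-- Satisfaction in the standard model `ℕ`. -/
def Fml.Sat (ρ : ℕ → ℕ) : Fml → Prop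
  | .eq s t => s.val ρ = t.val ρ
  | .ne s t => s.val ρ ≠ t.val ρ
  | .and A B => A.Sat ρ ∧ B.Sat ρ
  | .or A B => A.Sat ρ ∨ B.Sat ρ
  | .all A => ∀ n : ℕ, A.Sat (consEnv n ρ)
  | .ex A => ∃ n : ℕ, A.Sat (consEnv n ρ)

/-- Truth of a sentence in the standard model. -/
def sentTrue (A : Sentence) : Prop := A.1.Sat (fun _ => 0)

/-- Substitution of a closed term `t` for variable `k` in a term. -/
def Trm.sub (t : Trm) (k : ℕ) : Trm → Trm
  | .var i => if i = k then t else if k < i then .var (i - 1) else .var i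
  | .zero => .zero
  | .one => .one
  | .add s u => .add (Trm.sub t k s) (Trm.sub t k u)
  | .mul s u => .mul (Trm.sub t k s) (Trm.sub t k u)

/-- Substitution of a closed term `t` for variable `k` in a formula. -/
def Fml.sub (t : Trm) : Fml → ℕ → Fml
  | .eq s u, k => .eq (Trm.sub t k s) (Trm.sub t k u)
  | .ne s u, k => .ne (Trm.sub t k s) (Trm.sub t k u)
  | .and A B, k => .and (A.sub t k) (B.sub t k)
  | .or A B, k => .or (A.sub t k) (B.sub t k)
  | .all A, k => .all (A.sub t (k + 1))
  | .ex A, k => .ex (A.sub t (k + 1))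

/-- The numeral `n̄`. -/
def numeral : ℕ → Trm
  | 0 => .zero
  | n + 1 => .add (numeral n) .one

theorem Trm.cu_mono : ∀ (t : Trm) {j k : ℕ}, j ≤ k → t.cu j = true → t.cu k = true := by
  intro t
  induction t with
  | var i =>
    intro j k h ht
    simp only [Trm.cu, decide_eq_true_eq] at *
    omega
  | zero => intros; rfl
  | one => intros; rfl
  | add s u ihs ihu =>
    intro j k h ht
    simp only [Trm.cu, Bool.and_eq_true] at *
    exact ⟨ihs h ht.1, ihu h ht.2⟩
  | mul s u ihs ihu =>
    intro j k h ht
    simp only [Trm.cu, Bool.and_eq_true] at *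
    exact ⟨ihs h ht.1, ihu h ht.2⟩

theorem Trm.cu_sub : ∀ (s : Trm) {k : ℕ} {t : Trm},
    t.cu 0 = true → s.cu (k + 1) = true → (Trm.sub t k s).cu k = true := by
  intro s
  induction s with
  | var i =>
    intro k t ht hs
    simp only [Trm.cu, decide_eq_true_eq] at hs
    simp only [Trm.sub]
    by_cases h : i = k
    · rw [if_pos h]
      exact Trm.cu_mono t (Nat.zero_le k) ht
    · have h2 : ¬ k < i := by omega
      rw [if_neg h, if_neg h2]
      simp only [Trm.cu, decide_eq_true_eq]
      omega
  | zero => intros; rfl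
  | one => intros; rfl
  | add s u ihs ihu =>
    intro k t ht hs
    simp only [Trm.cu, Bool.and_eq_true] at hs
    simp only [Trm.sub, Trm.cu, Bool.and_eq_true]
    exact ⟨ihs ht hs.1, ihu ht hs.2⟩
  | mul s u ihs ihu =>
    intro k t ht hs
    simp only [Trm.cu, Bool.and_eq_true] at hs
    simp only [Trm.sub, Trm.cu, Bool.and_eq_true]
    exact ⟨ihs ht hs.1, ihu ht hs.2⟩

theorem Fml.cu_sub : ∀ (A : Fml) {k : ℕ} {t : Trm},
    t.cu 0 = true → A.cu (k + 1) = true → (A.sub t k).cu k = true := by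
  intro A
  induction A with
  | eq s u =>
    intro k t ht hA
    simp only [Fml.cu, Bool.and_eq_true] at hA
    simp only [Fml.sub, Fml.cu, Bool.and_eq_true]
    exact ⟨Trm.cu_sub s ht hA.1, Trm.cu_sub u ht hA.2⟩
  | ne s u =>
    intro k t ht hA
    simp only [Fml.cu, Bool.and_eq_true] at hA
    simp only [Fml.sub, Fml.cu, Bool.and_eq_true]
    exact ⟨Trm.cu_sub s ht hA.1, Trm.cu_sub u ht hA.2⟩
  | and A B ihA ihB =>
    intro k t ht h
    simp only [Fml.cu, Bool.and_eq_true] at h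
    simp only [Fml.sub, Fml.cu, Bool.and_eq_true]
    exact ⟨ihA ht h.1, ihB ht h.2⟩
  | or A B ihA ihB =>
    intro k t ht h
    simp only [Fml.cu, Bool.and_eq_true] at h
    simp only [Fml.sub, Fml.cu, Bool.and_eq_true]
    exact ⟨ihA ht h.1, ihB ht h.2⟩
  | all A ihA =>
    intro k t ht h
    simp only [Fml.cu] at h
    simp only [Fml.sub, Fml.cu]
    exact ihA ht h
  | ex A ihA =>
    intro k t ht h
    simp only [Fml.cu] at h
    simp only [Fml.sub, Fml.cu]
    exact ihA ht h

theorem numeral_cu : ∀ n : ℕ, (numeral n).cu 0 = true := by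
  intro n
  induction n with
  | zero => rfl
  | succ n ih => simp [numeral, Trm.cu, ih]

/-- Negation (de Morgan dual) of a formula in negation normal form. -/
def Fml.neg : Fml → Fml
  | .eq s t => .ne s t
  | .ne s t => .eq s t
  | .and A B => .or A.neg B.neg
  | .or A B => .and A.neg B.neg
  | .all A => .ex A.neg
  | .ex A => .all A.neg

theorem Fml.cu_neg : ∀ (A : Fml) {k : ℕ}, A.cu k = true → A.neg.cu k = true := by
  intro A
  induction A with
  | eq s u => intro k h; simpa [Fml.cu, Fml.neg] using h
  | ne s u => intro k h; simpa [Fml.cu, Fml.neg] using h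
  | and A B ihA ihB =>
    intro k h
    simp only [Fml.cu, Bool.and_eq_true] at h
    simp only [Fml.neg, Fml.cu, Bool.and_eq_true]
    exact ⟨ihA h.1, ihB h.2⟩
  | or A B ihA ihB =>
    intro k h
    simp only [Fml.cu, Bool.and_eq_true] at h
    simp only [Fml.neg, Fml.cu, Bool.and_eq_true]
    exact ⟨ihA h.1, ihB h.2⟩
  | all A ihA =>
    intro k h
    simp only [Fml.cu] at h
    simp only [Fml.neg, Fml.cu]
    exact ihA h
  | ex A ihA =>
    intro k h
    simp only [Fml.cu] at h
    simp only [Fml.neg, Fml.cu]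
    exact ihA h

/-- Conjunction of sentences. -/
def sAnd (A B : Sentence) : Sentence :=
  ⟨.and A.1 B.1, by simp [Fml.cu, A.2, B.2]⟩

/-- Disjunction of sentences. -/
def sOr (A B : Sentence) : Sentence :=
  ⟨.or A.1 B.1, by simp [Fml.cu, A.2, B.2]⟩

/-- Negation of a sentence. -/
def sNeg (A : Sentence) : Sentence := ⟨A.1.neg, Fml.cu_neg A.1 A.2⟩

/-- The sentence `∀x A(x)`, for `A` with (at most) one free variable. -/
def sAll (A : Fml) (h : A.cu 1 = true) : Sentence := ⟨.all A, by simpa [Fml.cu] using h⟩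

/-- The sentence `∃x A(x)`, for `A` with (at most) one free variable. -/
def sEx (A : Fml) (h : A.cu 1 = true) : Sentence := ⟨.ex A, by simpa [Fml.cu] using h⟩

/-- The instance `A(n̄)` of a formula `A` with one free variable. -/
def sInst (A : Fml) (h : A.cu 1 = true) (n : ℕ) : Sentence :=
  ⟨A.sub (numeral n) 0, Fml.cu_sub A (numeral_cu n) h⟩

/-- Literals: atomic and negated atomic formulas. -/
def Fml.isLiteral : Fml → Bool
  | .eq _ _ => true
  | .ne _ _ => true
  | _ => false

/-- Quantifier free formulas. -/
def Fml.qf : Fml → Bool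
  | .eq _ _ => true
  | .ne _ _ => true
  | .and A B => A.qf && B.qf
  | .or A B => A.qf && B.qf
  | .all _ => false
  | .ex _ => false

/-- An axiom is a sequent containing a true closed literal. -/
def IsAxiom (Γ : Finset Sentence) : Prop :=
  ∃ A ∈ Γ, A.1.isLiteral = true ∧ sentTrue A

/-- A sequent is true if some member is true. -/
def SeqTrue (Γ : Finset Sentence) : Prop := ∃ A ∈ Γ, sentTrue A


/-! ### A primitive recursive Gödel numbering of terms, sentences and sequents -/

/-- Gödel number of a term. -/
def Trm.enc : Trm → ℕ
  | .var i => 5 * i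
  | .zero => 1
  | .one => 2
  | .add s t => 5 * Nat.pair s.enc t.enc + 3
  | .mul s t => 5 * Nat.pair s.enc t.enc + 4

/-- Fuelled decoding of terms. -/
def Trm.dec : ℕ → ℕ → Option Trm
  | 0, _ => none
  | fuel + 1, n =>
    if n % 5 = 0 then some (.var (n / 5))
    else if n % 5 = 1 then some .zero
    else if n % 5 = 2 then some .one
    else if n % 5 = 3 then
      match Trm.dec fuel (n / 5).unpair.1, Trm.dec fuel (n / 5).unpair.2 with
      | some s, some t => some (.add s t)
      | _, _ => none
    else
      match Trm.dec fuel (n / 5).unpair.1, Trm.dec fuel (n / 5).unpair.2 with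
      | some s, some t => some (.mul s t)
      | _, _ => none

theorem Trm.dec_enc : ∀ (t : Trm) (fuel : ℕ), t.enc < fuel → Trm.dec fuel t.enc = some t := by
  intro t
  induction t with
  | var i =>
    intro fuel h
    match fuel with
    | f + 1 =>
      have h0 : (5 * i) % 5 = 0 := by omega
      have h1 : (5 * i) / 5 = i := by omega
      simp [Trm.dec, Trm.enc, h0, h1]
  | zero =>
    intro fuel h
    match fuel with
    | f + 1 => simp [Trm.dec, Trm.enc]
  | one =>
    intro fuel h
    match fuel with
    | f + 1 => simp [Trm.dec, Trm.enc]
  | add s u ihs ihu =>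
    intro fuel h
    match fuel with
    | f + 1 =>
      simp only [Trm.enc] at h ⊢
      set p := Nat.pair s.enc u.enc with hp
      have h0 : (5 * p + 3) % 5 = 3 := by omega
      have h1 : (5 * p + 3) / 5 = p := by omega
      have hs : s.enc < f := by
        have := Nat.left_le_pair s.enc u.enc
        omega
      have hu : u.enc < f := by
        have := Nat.right_le_pair s.enc u.enc
        omega
      simp only [Trm.dec, h0, h1]
      rw [hp, Nat.unpair_pair, ihs f hs, ihu f hu]
      simp
  | mul s u ihs ihu =>
    intro fuel h
    match fuel with
    | f + 1 =>
      simp only [Trm.enc] at h ⊢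
      set p := Nat.pair s.enc u.enc with hp
      have h0 : (5 * p + 4) % 5 = 4 := by omega
      have h1 : (5 * p + 4) / 5 = p := by omega
      have hs : s.enc < f := by
        have := Nat.left_le_pair s.enc u.enc
        omega
      have hu : u.enc < f := by
        have := Nat.right_le_pair s.enc u.enc
        omega
      simp only [Trm.dec, h0, h1]
      rw [hp, Nat.unpair_pair, ihs f hs, ihu f hu]
      simp

instance : Encodable Trm :=
  ⟨Trm.enc, fun n => Trm.dec (n + 1) n, fun t => Trm.dec_enc t _ (Nat.lt_succ_self _)⟩

/-- Gödel number of a formula. -/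
def Fml.enc : Fml → ℕ
  | .eq s t => 6 * Nat.pair s.enc t.enc
  | .ne s t => 6 * Nat.pair s.enc t.enc + 1
  | .and A B => 6 * Nat.pair A.enc B.enc + 2
  | .or A B => 6 * Nat.pair A.enc B.enc + 3
  | .all A => 6 * A.enc + 4
  | .ex A => 6 * A.enc + 5

/-- Fuelled decoding of formulas. -/
def Fml.dec : ℕ → ℕ → Option Fml
  | 0, _ => none
  | fuel + 1, n =>
    if n % 6 = 0 then
      match Encodable.decode (α := Trm) (n / 6).unpair.1,
            Encodable.decode (α := Trm) (n / 6).unpair.2 with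
      | some s, some t => some (.eq s t)
      | _, _ => none
    else if n % 6 = 1 then
      match Encodable.decode (α := Trm) (n / 6).unpair.1,
            Encodable.decode (α := Trm) (n / 6).unpair.2 with
      | some s, some t => some (.ne s t)
      | _, _ => none
    else if n % 6 = 2 then
      match Fml.dec fuel (n / 6).unpair.1, Fml.dec fuel (n / 6).unpair.2 with
      | some A, some B => some (.and A B)
      | _, _ => none
    else if n % 6 = 3 then
      match Fml.dec fuel (n / 6).unpair.1, Fml.dec fuel (n / 6).unpair.2 with
      | some A, some B => some (.or A B)
      | _, _ => none
    else if n % 6 = 4 then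
      match Fml.dec fuel (n / 6) with
      | some A => some (.all A)
      | none => none
    else
      match Fml.dec fuel (n / 6) with
      | some A => some (.ex A)
      | none => none

theorem Fml.dec_enc : ∀ (A : Fml) (fuel : ℕ), A.enc < fuel → Fml.dec fuel A.enc = some A := by
  intro A
  induction A with
  | eq s u =>
    intro fuel h
    match fuel with
    | f + 1 =>
      simp only [Fml.enc] at h ⊢
      set p := Nat.pair s.enc u.enc with hp
      have h0 : (6 * p) % 6 = 0 := by omega
      have h1 : (6 * p) / 6 = p := by omega
      have hds : Encodable.decode (α := Trm) s.enc = some s := Encodable.encodek s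
      have hdu : Encodable.decode (α := Trm) u.enc = some u := Encodable.encodek u
      simp only [Fml.dec, h0, h1]
      rw [hp, Nat.unpair_pair, hds, hdu]
      simp
  | ne s u =>
    intro fuel h
    match fuel with
    | f + 1 =>
      simp only [Fml.enc] at h ⊢
      set p := Nat.pair s.enc u.enc with hp
      have h0 : (6 * p + 1) % 6 = 1 := by omega
      have h1 : (6 * p + 1) / 6 = p := by omega
      have hds : Encodable.decode (α := Trm) s.enc = some s := Encodable.encodek s
      have hdu : Encodable.decode (α := Trm) u.enc = some u := Encodable.encodek u
      simp only [Fml.dec, h0, h1]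
      rw [hp, Nat.unpair_pair, hds, hdu]
      simp
  | and A B ihA ihB =>
    intro fuel h
    match fuel with
    | f + 1 =>
      simp only [Fml.enc] at h ⊢
      set p := Nat.pair A.enc B.enc with hp
      have h0 : (6 * p + 2) % 6 = 2 := by omega
      have h1 : (6 * p + 2) / 6 = p := by omega
      have hA : A.enc < f := by
        have := Nat.left_le_pair A.enc B.enc
        omega
      have hB : B.enc < f := by
        have := Nat.right_le_pair A.enc B.enc
        omega
      simp only [Fml.dec, h0, h1]
      rw [hp, Nat.unpair_pair, ihA f hA, ihB f hB]
      simp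
  | or A B ihA ihB =>
    intro fuel h
    match fuel with
    | f + 1 =>
      simp only [Fml.enc] at h ⊢
      set p := Nat.pair A.enc B.enc with hp
      have h0 : (6 * p + 3) % 6 = 3 := by omega
      have h1 : (6 * p + 3) / 6 = p := by omega
      have hA : A.enc < f := by
        have := Nat.left_le_pair A.enc B.enc
        omega
      have hB : B.enc < f := by
        have := Nat.right_le_pair A.enc B.enc
        omega
      simp only [Fml.dec, h0, h1]
      rw [hp, Nat.unpair_pair, ihA f hA, ihB f hB]
      simp
  | all A ihA =>
    intro fuel h
    match fuel with
    | f + 1 =>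
      simp only [Fml.enc] at h ⊢
      have h0 : (6 * A.enc + 4) % 6 = 4 := by omega
      have h1 : (6 * A.enc + 4) / 6 = A.enc := by omega
      have hA : A.enc < f := by omega
      simp [Fml.dec, h0, h1, ihA f hA]
  | ex A ihA =>
    intro fuel h
    match fuel with
    | f + 1 =>
      simp only [Fml.enc] at h ⊢
      have h0 : (6 * A.enc + 5) % 6 = 5 := by omega
      have h1 : (6 * A.enc + 5) / 6 = A.enc := by omega
      have hA : A.enc < f := by omega
      simp [Fml.dec, h0, h1, ihA f hA]

instance : Encodable Fml :=
  ⟨Fml.enc, fun n => Fml.dec (n + 1) n, fun A => Fml.dec_enc A _ (Nat.lt_succ_self _)⟩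

/-- Gödel number of a sentence. -/
def encF (A : Sentence) : ℕ := Encodable.encode A

/-- Gödel number of a sequent (finite set of sentences). -/
def encS (Γ : Finset Sentence) : ℕ := Encodable.encode Γ

/-- Decode a Gödel number into a sentence (with a default value). -/
def decF (n : ℕ) : Sentence := (Encodable.decode (α := Sentence) n).getD ⟨.eq .zero .zero, rfl⟩

/-- Decode a Gödel number into a sequent (with a default value). -/
def decS (n : ℕ) : Finset Sentence := (Encodable.decode (α := Finset Sentence) n).getD ∅

/-! ### Tupling of natural numbers, with projections -/

/-- Code of a finite sequence (tuple) of natural numbers; codes are nonzero. -/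
def tup (l : List ℕ) : ℕ := Encodable.encode l + 1

/-- The finite sequence coded by a natural number. -/
def untup (a : ℕ) : List ℕ := Denumerable.ofNat (List ℕ) (a - 1)

/-- The `i`-th projection `(a)_i`. -/
def proj (a i : ℕ) : ℕ := (untup a).getD i 0

/-- `a` codes a finite sequence (every nonzero number does, bijectively). -/
def InSeq (a : ℕ) : Prop := a ≠ 0

/-- The code of the empty sequence `⟨⟩` (the root). -/
def rootSeq : ℕ := tup []

/-- The code of `σ⌢i`. -/
def snoc (σ i : ℕ) : ℕ := tup (untup σ ++ [i])

/-! ### Names for the inference rules -/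

def axC : ℕ := 1
def andC : ℕ := 2
def orC : ℕ := 3
def omC : ℕ := 4
def exC : ℕ := 5
def cutC : ℕ := 6
def omrepC : ℕ := 7

/-- The end sequent of a (code of a) proof or proof node: `(a)_1` if the rule
`(a)_0` carries no main formula, and `(a)_1 ∪ {(a)_2}` otherwise. -/
def EndS (a : ℕ) : Finset Sentence :=
  if proj a 0 = cutC ∨ proj a 0 = axC ∨ proj a 0 = omrepC then decS (proj a 1)
  else decS (proj a 1) ∪ {decF (proj a 2)}

/-! ### Local codes of ω-proofs -/

/-- Local codes of `ω`-proofs, in Tait style.  The three `Bool` parameters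
respectively allow the cut rule, restrict the `ω`-rule to indices of primitive
recursive functions, and allow the vacuous `ω`-repetition rule. -/
inductive CGen (c p r : Bool) : ℕ → Prop
  | ax (Γ : Finset Sentence) (h : IsAxiom Γ) : CGen c p r (tup [axC, encS Γ])
  | and {a b : ℕ} (Γ : Finset Sentence) (A B : Sentence)
      (ha : CGen c p r a) (hb : CGen c p r b)
      (ea : EndS a = Γ ∪ {A}) (eb : EndS b = Γ ∪ {B}) :
      CGen c p r (tup [andC, encS Γ, encF (sAnd A B), a, b])
  | or {a : ℕ} (Γ : Finset Sentence) (A B : Sentence) (ha : CGen c p r a)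
      (ea : EndS a = Γ ∪ {A, B}) :
      CGen c p r (tup [orC, encS Γ, encF (sOr A B), a])
  | om {e : ℕ} (Γ : Finset Sentence) (A : Fml) (hA : A.cu 1 = true)
      (hp : p = true → PrimIndex e)
      (htot : ∀ n, (peval e n).Dom)
      (hmem : ∀ n, CGen c p r ((peval e n).get (htot n)))
      (hend : ∀ n, EndS ((peval e n).get (htot n)) = Γ ∪ {sInst A hA n}) :
      CGen c p r (tup [omC, encS Γ, encF (sAll A hA), e])
  | ex {a : ℕ} (Γ : Finset Sentence) (A : Fml) (hA : A.cu 1 = true) (n : ℕ)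
      (ha : CGen c p r a) (ea : EndS a = Γ ∪ {sInst A hA n}) :
      CGen c p r (tup [exC, encS Γ, encF (sEx A hA), a])
  | cut {a b : ℕ} (hc : c = true) (Γ : Finset Sentence) (C : Sentence)
      (ha : CGen c p r a) (hb : CGen c p r b)
      (ea : EndS a = Γ ∪ {C}) (eb : EndS b = Γ ∪ {sNeg C}) :
      CGen c p r (tup [cutC, encS Γ, encF C, a, b])
  | omrep {e : ℕ} (hr : r = true) (Γ : Finset Sentence) (hp : PrimIndex e)
      (htot : ∀ n, (peval e n).Dom)
      (hmem : ∀ n, CGen c p r ((peval e n).get (htot n)))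
      (hend : ∀ n, EndS ((peval e n).get (htot n)) = Γ) :
      CGen c p r (tup [omrepC, encS Γ, e])

/-- `C_rec`: recursive local codes of `ω`-proofs. -/
def Crec : ℕ → Prop := CGen true false false

/-- `C_rec^-`: the cut free fragment of `C_rec`. -/
def CrecM : ℕ → Prop := CGen false false false

/-- `C_prec`: primitive recursive local codes of `ω`-proofs. -/
def Cprec : ℕ → Prop := CGen true true false

/-- `C_prec^-`: the cut free fragment of `C_prec`. -/
def CprecM : ℕ → Prop := CGen false true false

/-- `C_prec^{ω-rep}`: `C_prec` with the vacuous `ω`-repetition rule. -/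
def CprecRep : ℕ → Prop := CGen true true true

/-! ### ω-proofs as well founded trees of sequents -/

/-- `σ` is a node of the tree `T_π = {σ ∈ Seq : π(σ) ∈ Seq}`. -/
def TreeOf (π : ℕ → ℕ) (σ : ℕ) : Prop := σ ≠ 0 ∧ π σ ≠ 0

/-- The tree `T_π` is well founded: it has no infinite branch. -/
def WFTree (π : ℕ → ℕ) : Prop :=
  ¬ ∃ f : ℕ → ℕ, ∀ n : ℕ, TreeOf π (tup ((List.range n).map f))

/-- The inference at an inner node of an `ω`-proof is a correct instance of one
of the rules of Tait-style `ω`-arithmetic. -/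
def CorrectInner (π : ℕ → ℕ) (σ : ℕ) : Prop :=
  (∃ (Γ : Finset Sentence) (A B : Sentence),
    π σ = tup [andC, encS Γ, encF (sAnd A B)] ∧
    TreeOf π (snoc σ 0) ∧ TreeOf π (snoc σ 1) ∧ ¬ TreeOf π (snoc σ 2) ∧
    EndS (π (snoc σ 0)) = Γ ∪ {A} ∧ EndS (π (snoc σ 1)) = Γ ∪ {B}) ∨
  (∃ (Γ : Finset Sentence) (A B : Sentence),
    π σ = tup [orC, encS Γ, encF (sOr A B)] ∧
    TreeOf π (snoc σ 0) ∧ ¬ TreeOf π (snoc σ 1) ∧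
    EndS (π (snoc σ 0)) = Γ ∪ {A, B}) ∨
  (∃ (Γ : Finset Sentence) (A : Fml) (hA : A.cu 1 = true),
    π σ = tup [omC, encS Γ, encF (sAll A hA)] ∧
    (∀ n : ℕ, TreeOf π (snoc σ n)) ∧
    (∀ n : ℕ, EndS (π (snoc σ n)) = Γ ∪ {sInst A hA n})) ∨
  (∃ (Γ : Finset Sentence) (A : Fml) (hA : A.cu 1 = true) (n : ℕ),
    π σ = tup [exC, encS Γ, encF (sEx A hA)] ∧
    TreeOf π (snoc σ 0) ∧ ¬ TreeOf π (snoc σ 1) ∧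
    EndS (π (snoc σ 0)) = Γ ∪ {sInst A hA n}) ∨
  (∃ (Γ : Finset Sentence) (C : Sentence),
    π σ = tup [cutC, encS Γ, encF C] ∧
    TreeOf π (snoc σ 0) ∧ TreeOf π (snoc σ 1) ∧ ¬ TreeOf π (snoc σ 2) ∧
    EndS (π (snoc σ 0)) = Γ ∪ {C} ∧ EndS (π (snoc σ 1)) = Γ ∪ {sNeg C})

/-- Local correctness of a function `π : ℕ → ℕ` viewed as a tree of sequents:
all conditions in the definition of `ω`-proof except well-foundedness. -/
structure LocallyCorrect (π : ℕ → ℕ) : Prop where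
  /-- values outside `Seq` are `0` -/
  nonseq : ∀ σ, ¬ InSeq (π σ) → π σ = 0
  /-- `T_π` is closed under initial segments -/
  downward : ∀ σ τ, TreeOf π σ → τ ≠ 0 → untup τ <+: untup σ → TreeOf π τ
  /-- children come first -/
  mono : ∀ σ i j, i < j → TreeOf π (snoc σ j) → TreeOf π (snoc σ i)
  /-- top nodes are axioms -/
  top : ∀ σ, TreeOf π σ → ¬ TreeOf π (snoc σ 0) →
    ∃ Γ : Finset Sentence, IsAxiom Γ ∧ π σ = tup [axC, encS Γ]
  /-- inner nodes are correct inferences -/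
  inner : ∀ σ, TreeOf π σ → TreeOf π (snoc σ 0) → CorrectInner π σ

/-- `π : ℕ → ℕ` is an `ω`-proof. -/
structure IsOmegaProof (π : ℕ → ℕ) extends LocallyCorrect π : Prop where
  /-- the tree `T_π` is well founded -/
  wf : WFTree π

/-- An `ω`-proof is cut free if no node is labelled `cut`. -/
def CutFree (π : ℕ → ℕ) : Prop := ∀ σ, TreeOf π σ → proj (π σ) 0 ≠ cutC

/-! ### The ω-proof `π(a)` coded by a local code `a` -/

open Classical in
/-- The code of the subproof at child `n` of the proof coded by `a`. -/
noncomputable def childCode (a n : ℕ) : ℕ :=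
  if proj a 0 = omC then
    (if h : (peval (proj a 3) n).Dom then (peval (proj a 3) n).get h else 0)
  else if proj a 0 = andC ∨ proj a 0 = orC ∨ proj a 0 = exC ∨ proj a 0 = cutC then
    proj a (n + 3)
  else 0

/-- Walk down a local code along a path. -/
noncomputable def walkCode (a : ℕ) : List ℕ → ℕ
  | [] => a
  | i :: l => walkCode (childCode a i) l

/-- The node label `⟨R,Γ,A⟩` (or `⟨Ax,Γ⟩`) determined by a local code. -/
def nodeVal (b : ℕ) : ℕ :=
  if proj b 0 = axC then tup [axC, proj b 1]
  else if proj b 0 = andC ∨ proj b 0 = orC ∨ proj b 0 = omC ∨ proj b 0 = exC ∨ proj b 0 = cutC then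
    tup [proj b 0, proj b 1, proj b 2]
  else 0

/-- The `ω`-proof `π(a)` determined by a local code `a` (with value `0` at all
other arguments). -/
noncomputable def piOf (a : ℕ) (σ : ℕ) : ℕ :=
  if σ = 0 then 0 else nodeVal (walkCode a (untup σ))

/-! ### Indices (global codes) of recursive and primitive recursive ω-proofs -/

/-- `I_rec`: `a` is an index of a recursive `ω`-proof. -/
def Irec (a : ℕ) : Prop :=
  ∃ h : ∀ n, (peval a n).Dom, IsOmegaProof (fun n => (peval a n).get (h n))

/-- `I_prec`: `a` is an index of a primitive recursive `ω`-proof. -/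
def Iprec (a : ℕ) : Prop :=
  ∃ f : ℕ → ℕ, Nat.Primrec f ∧ (∀ n, peval a n = Part.some (f n)) ∧ IsOmegaProof f

/-- `I_prec^-`: `a` is an index of a primitive recursive cut free `ω`-proof. -/
def IprecM (a : ℕ) : Prop :=
  ∃ f : ℕ → ℕ, Nat.Primrec f ∧ (∀ n, peval a n = Part.some (f n)) ∧
    IsOmegaProof f ∧ CutFree f

/-! ### Ordinal lengths -/

open Classical in
/-- `x + 1` if `P` holds, and `0` otherwise. -/
noncomputable def succIf (P : Prop) (x : Ordinal.{0}) : Ordinal.{0} :=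
  if P then x + 1 else 0

/-- The ordinal rank of a node of the tree `T_π`:
`rank σ = sup {rank (σ⌢i) + 1 : σ⌢i ∈ T_π}`. -/
inductive NodeRank (π : ℕ → ℕ) : ℕ → Ordinal.{0} → Prop
  | mk (σ : ℕ) (o : ℕ → Ordinal.{0})
      (h : ∀ i, TreeOf π (snoc σ i) → NodeRank π (snoc σ i) (o i)) :
      NodeRank π σ (⨆ i, succIf (TreeOf π (snoc σ i)) (o i))

/-- The ordinal length of a local code:  `|⟨Ax,Γ⟩| = 0`,
`|⟨R,Γ,A,a₁,…,a_k⟩| = sup{|a₁|,…,|a_k|} + 1`, and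
`|⟨ω,Γ,∀xA(x),e⟩| = sup{|⟨e⟩(n)| + 1 : n ∈ ℕ}`. -/
inductive CLen : ℕ → Ordinal.{0} → Prop
  | ax (g : ℕ) : CLen (tup [axC, g]) 0
  | one (R g x a : ℕ) (o : Ordinal.{0}) (hR : R = orC ∨ R = exC) (h : CLen a o) :
      CLen (tup [R, g, x, a]) (o + 1)
  | two (R g x a b : ℕ) (oa ob : Ordinal.{0}) (hR : R = andC ∨ R = cutC)
      (ha : CLen a oa) (hb : CLen b ob) :
      CLen (tup [R, g, x, a, b]) ((oa ⊔ ob) + 1)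
  | om (g x e : ℕ) (h : ∀ n, (peval e n).Dom) (o : ℕ → Ordinal.{0})
      (ho : ∀ n, CLen ((peval e n).get (h n)) (o n)) :
      CLen (tup [omC, g, x, e]) (⨆ n, o n + 1)

/-- The ordinal `|a|` of a notation `a ∈ O`:  `|1| = 0`, `|2^a| = |a| + 1`,
`|3·5^e| = sup{|⟨e⟩(n)| : n ∈ ℕ}`. -/
inductive KOrd : ℕ → Ordinal.{0} → Prop
  | one : KOrd 1 0
  | step {a : ℕ} {o : Ordinal.{0}} : KOrd a o → KOrd (2 ^ a) (o + 1)
  | lim {e : ℕ} (h : ∀ n, (peval e n).Dom) (o : ℕ → Ordinal.{0})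
      (ho : ∀ n, KOrd ((peval e n).get (h n)) (o n)) :
      KOrd (3 * 5 ^ e) (⨆ n, o n)


open Classical in
/-- One step of the sequence `a(f)` determined by a local code. -/
noncomputable def branchStep (b k : ℕ) : Option ℕ :=
  if (∃ (Γ : Finset Sentence) (A B : Sentence) (b₀ b₁ : ℕ),
        b = tup [andC, encS Γ, encF (sAnd A B), b₀, b₁]) ∨
     (∃ (Γ : Finset Sentence) (C : Sentence) (b₀ b₁ : ℕ),
        b = tup [cutC, encS Γ, encF C, b₀, b₁]) then
    some (proj b (3 + k % 2))
  else if ∃ (Γ : Finset Sentence) (A B : Sentence) (c : ℕ),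
      b = tup [orC, encS Γ, encF (sOr A B), c] then
    some (proj b 3)
  else if ∃ (Γ : Finset Sentence) (A : Fml) (hA : A.cu 1 = true) (e : ℕ),
      b = tup [omC, encS Γ, encF (sAll A hA), e] then
    (if h : (peval (proj b 3) k).Dom then some ((peval (proj b 3) k).get h) else none)
  else none

/-- The sequence `a(f) = ⟨a₀,a₁,…⟩`:  `chain a f i = some aᵢ` if the `i`-th
element of the sequence is defined, and `none` otherwise. -/
noncomputable def chain (a : ℕ) (f : ℕ → ℕ) : ℕ → Option ℕ
  | 0 => some a
  | i + 1 =>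
    match chain a f i with
    | none => none
    | some b => branchStep b (f i)

/-! ### Primitive recursiveness of the coding -/

theorem encode_list_map_encode {α : Type*} [Encodable α] (l : List α) :
    Encodable.encode (l.map Encodable.encode) = Encodable.encode l := by
  induction l with
  | nil => rfl
  | cons a l ih => simp [ih]

theorem encF_injective : Function.Injective encF := Encodable.encode_injective

/-- The Gödel number of a sequent codes the increasing list of the Gödel numbers of its members. -/
theorem encS_eq_encode_sort (Γ : Finset Sentence) :
    encS Γ = Encodable.encode ((Γ.image encF).sort (· ≤ ·)) := by
  have pairwise_sort : ∀ (r : Sentence → Sentence → Prop) {_ : DecidableRel r}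
      {_ : IsTrans Sentence r} {_ : Std.Antisymm r} {_ : Std.Total r} (s : Multiset Sentence),
      (s.sort r).Pairwise r := fun r _ _ _ _ s => Multiset.pairwise_sort s r
  obtain ⟨l, hl, hsort, hmem, hnodup⟩ : ∃ l : List Sentence, encS Γ = Encodable.encode l ∧
      (l.map encF).Pairwise (· ≤ ·) ∧ (∀ A, A ∈ l ↔ A ∈ Γ) ∧ l.Nodup := by
    refine ⟨_, rfl, ?_, ?_, ?_⟩
    · rw [List.pairwise_map]
      refine List.Pairwise.imp ?_ (pairwise_sort _ _)
      exact id
    · intro A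
      rw [← Multiset.mem_coe, Multiset.sort_eq, Finset.mem_val]
    · rw [← Multiset.coe_nodup, Multiset.sort_eq]
      exact Γ.nodup
  rw [hl, ← encode_list_map_encode l]
  congr 1
  refine List.SortedLT.eq_of_mem_iff ?_ (Finset.sortedLT_sort _) ?_
  · exact (hsort.sortedLE).sortedLT_of_nodup (hnodup.map encF_injective)
  · intro x
    rw [Finset.mem_sort, Finset.mem_image, List.mem_map]
    simp only [hmem]
    rfl

theorem sort_insert_eq (x : ℕ) (s : Finset ℕ) :
    (insert x s).sort (· ≤ ·) = (s.sort (· ≤ ·)).filter (· < x) ++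
      x :: (s.sort (· ≤ ·)).filter (x < ·) := by
  refine List.SortedLT.eq_of_mem_iff (Finset.sortedLT_sort _) ?_ ?_
  · have h := (Finset.sortedLT_sort s).pairwise
    refine List.Pairwise.sortedLT ?_
    rw [List.pairwise_append, List.pairwise_cons]
    refine ⟨h.filter _, ⟨by simp, h.filter _⟩, ?_⟩
    simp only [List.mem_filter, List.mem_cons, decide_eq_true_eq]
    rintro a ⟨-, ha⟩ b (rfl | ⟨-, hb⟩)
    · exact ha
    · exact ha.trans hb
  · intro a
    simp only [Finset.mem_sort, Finset.mem_insert, List.mem_append, List.mem_filter,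
      List.mem_cons, decide_eq_true_eq]
    rcases lt_trichotomy a x with h | h | h
    · simp [h, h.ne, h.le]
    · simp [h]
    · simp [h, h.ne', h.le]

/-- Adjoin the sentence with Gödel number `x` to the sequent with Gödel number `g`. -/
def insCode (x g : ℕ) : ℕ :=
  Encodable.encode ((Denumerable.ofNat (List ℕ) g).filter (· < x) ++
    x :: (Denumerable.ofNat (List ℕ) g).filter (x < ·))

theorem insCode_encF_encS (A : Sentence) (Γ : Finset Sentence) :
    insCode (encF A) (encS Γ) = encS (Γ ∪ {A}) := by
  rw [Finset.union_comm, ← Finset.insert_eq, encS_eq_encode_sort, encS_eq_encode_sort,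
    Finset.image_insert, sort_insert_eq, insCode, Denumerable.ofNat_encode]

theorem primrec₂_insCode : Primrec₂ insCode := by
  have hl : Primrec fun p : ℕ × ℕ => Denumerable.ofNat (List ℕ) p.2 :=
    (Primrec.ofNat _).comp Primrec.snd
  have hlt : PrimrecRel fun a b : ℕ => a < b := Primrec.nat_lt
  have hgt : PrimrecRel fun a b : ℕ => b < a := Primrec.nat_lt.comp Primrec.snd Primrec.fst
  exact Primrec.encode.comp (Primrec.list_append.comp (hlt.listFilter.comp hl Primrec.fst)
    (Primrec.list_cons.comp Primrec.fst (hgt.listFilter.comp hl Primrec.fst)))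

theorem primrec_tup : Primrec tup := Primrec.succ.comp Primrec.encode

theorem primrec_untup : Primrec untup :=
  (Primrec.ofNat _).comp Primrec.pred

theorem primrec₂_proj : Primrec₂ proj :=
  (Primrec.list_getD 0).comp (primrec_untup.comp Primrec.fst) Primrec.snd

theorem primrec₂_snoc : Primrec₂ snoc :=
  primrec_tup.comp (Primrec.list_concat.comp (primrec_untup.comp Primrec.fst) Primrec.snd)

@[simp]
theorem untup_tup (l : List ℕ) : untup (tup l) = l := by
  simp [untup, tup]

@[simp]
theorem snoc_tup (l : List ℕ) (i : ℕ) : snoc (tup l) i = tup (l ++ [i]) := by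
  simp [snoc]

@[simp]
theorem proj_tup (l : List ℕ) (i : ℕ) : proj (tup l) i = l.getD i 0 := by
  simp [proj]

@[simp]
theorem decS_encS (Γ : Finset Sentence) : decS (encS Γ) = Γ := by
  simp [decS, encS]

@[simp]
theorem decF_encF (A : Sentence) : decF (encF A) = A := by
  simp [decF, encF]

/-! ### Delaying a proof by a cut on a vacuous quantification -/

/-- The false closed literal `0 = 1`. -/
def falsum : Sentence := ⟨.eq .zero .one, rfl⟩

/-- The vacuous quantification `∀x (0 = 1)` of the false literal. -/
def allFalsum : Sentence := sAll falsum.1 rfl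

theorem sInst_falsum (n : ℕ) : sInst falsum.1 rfl n = falsum := rfl

theorem sInst_neg_falsum (n : ℕ) : sInst (sNeg falsum).1 rfl n = sNeg falsum := rfl

theorem sNeg_allFalsum : sNeg allFalsum = sEx (sNeg falsum).1 rfl := rfl

theorem isAxiom_union_neg_falsum (Γ : Finset Sentence) : IsAxiom (Γ ∪ {sNeg falsum}) :=
  ⟨sNeg falsum, by simp, rfl, by simp [sentTrue, sNeg, falsum, Fml.neg, Fml.Sat, Trm.val]⟩

theorem EndS_tup_axC (Γ : Finset Sentence) : EndS (tup [axC, encS Γ]) = Γ := by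
  simp [EndS]

theorem EndS_tup_cutC (Γ : Finset Sentence) (l : List ℕ) :
    EndS (tup (cutC :: encS Γ :: l)) = Γ := by
  simp [EndS]

theorem EndS_tup {R : ℕ} (hR : R ≠ cutC ∧ R ≠ axC ∧ R ≠ omrepC) (Γ : Finset Sentence)
    (A : Sentence) (l : List ℕ) : EndS (tup (R :: encS Γ :: encF A :: l)) = Γ ∪ {A} := by
  simp [EndS, hR]

theorem CGen.om_of_primrec {c p r : Bool} {e : ℕ} {g : ℕ → ℕ} (hg : Nat.Primrec g)
    (he : ∀ n, peval e n = Part.some (g n)) (Γ : Finset Sentence) (A : Fml) (hA : A.cu 1 = true)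
    (hmem : ∀ n, CGen c p r (g n)) (hend : ∀ n, EndS (g n) = Γ ∪ {sInst A hA n}) :
    CGen c p r (tup [omC, encS Γ, encF (sAll A hA), e]) := by
  have hget : ∀ n (h : (peval e n).Dom), (peval e n).get h = g n := fun n h => by
    simp [he n]
  refine CGen.om Γ A hA (fun _ => ⟨g, hg, he⟩) (fun n => by simp [he n]) (fun n => ?_) fun n => ?_
  · rw [hget]
    exact hmem n
  · rw [hget]
    exact hend n

/-- A local code for the sequent with Gödel number `g`, obtained from an index `e` of a function
all of whose values are local codes for this sequent, which is supposed to contain `0 = 1`: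
the `ω`-rule introduces `∀x (0 = 1)`, which is then cut away. -/
def delayCode (e g : ℕ) : ℕ :=
  tup [cutC, g, encF allFalsum, tup [omC, g, encF allFalsum, e],
    tup [exC, g, encF (sNeg allFalsum), tup [axC, insCode (encF (sNeg falsum)) g]]]

theorem EndS_delayCode (e : ℕ) (Γ : Finset Sentence) : EndS (delayCode e (encS Γ)) = Γ :=
  EndS_tup_cutC Γ _

theorem cprec_delayCode {e b : ℕ} (he : ∀ n, peval e n = Part.some b) {Γ : Finset Sentence}
    (hΓ : falsum ∈ Γ) (hb : Cprec b) (hend : EndS b = Γ) : Cprec (delayCode e (encS Γ)) := by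
  rw [delayCode, insCode_encF_encS]
  refine CGen.cut rfl Γ allFalsum ?_ ?_ ?_ ?_
  · refine CGen.om_of_primrec (Nat.Primrec.const b) he Γ falsum.1 rfl (fun _ => hb) fun n => ?_
    rw [hend, sInst_falsum, Finset.union_eq_left.2 (Finset.singleton_subset_iff.2 hΓ)]
  · exact CGen.ex Γ (sNeg falsum).1 rfl 0 (CGen.ax _ (isAxiom_union_neg_falsum Γ))
      (EndS_tup_axC _)
  · exact EndS_tup (by decide) Γ allFalsum _
  · exact EndS_tup (by decide) Γ (sNeg allFalsum) _

/-! ### The translation of indices into local codes -/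

open Nat.Partrec (Code)

/-- The Gödel number of the end sequent of a node label `v`. -/
def endCode (v : ℕ) : ℕ :=
  if proj v 0 = cutC ∨ proj v 0 = axC ∨ proj v 0 = omrepC then proj v 1
  else insCode (proj v 2) (proj v 1)

/-- The delayed local code of the `i`-th premise, where `q` is a program computing local codes of
the premises and `v` is the label of the `i`-th premise. -/
def premiseCode (q : Code) (i v : ℕ) : ℕ :=
  delayCode (Encodable.encode (q.comp (Code.const i))) (insCode (encF falsum) (endCode v))

/-- The local code of the subproof at a node with label `v`, with `0 = 1` added to all sequents.
Here `q` is a program computing local codes of the premises, the first two of which have the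
labels `v₀` and `v₁`. -/
def nodeCode (q : Code) (v v₀ v₁ : ℕ) : ℕ :=
  if proj v 0 = axC then tup [axC, insCode (encF falsum) (proj v 1)]
  else if proj v 0 = omC then
    tup [omC, insCode (encF falsum) (proj v 1), proj v 2, Encodable.encode q]
  else if proj v 0 = andC ∨ proj v 0 = cutC then
    tup [proj v 0, insCode (encF falsum) (proj v 1), proj v 2, premiseCode q 0 v₀,
      premiseCode q 1 v₁]
  else tup [proj v 0, insCode (encF falsum) (proj v 1), proj v 2, premiseCode q 0 v₀]

/-- The local code of the subproof at the node `τ` of the `ω`-proof `⟨a⟩`, where `c` is a program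
for `⟨⟨a, σ⟩, n⟩ ↦ subproofCode c a (snoc σ n)`. -/
def subproofCode (c : Code) (a τ : ℕ) : Part ℕ :=
  (peval a τ).bind fun v => (peval a (snoc τ 0)).bind fun v₀ => (peval a (snoc τ 1)).map fun v₁ =>
    nodeCode (c.curry (Nat.pair a τ)) v v₀ v₁

theorem subproofCode_eq {a : ℕ} {f : ℕ → ℕ} (ha : ∀ n, peval a n = Part.some (f n)) (c : Code)
    (τ : ℕ) : subproofCode c a τ = Part.some
      (nodeCode (c.curry (Nat.pair a τ)) (f τ) (f (snoc τ 0)) (f (snoc τ 1))) := by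
  simp [subproofCode, ha]

section Primrec

variable {α : Type*} [Primcodable α]

theorem primrec_tup_two {f g : α → ℕ} (hf : Primrec f) (hg : Primrec g) :
    Primrec fun x => tup [f x, g x] :=
  primrec_tup.comp (Primrec.list_cons.comp hf (Primrec.list_cons.comp hg (Primrec.const [])))

theorem primrec_tup_four {f g h k : α → ℕ} (hf : Primrec f) (hg : Primrec g) (hh : Primrec h)
    (hk : Primrec k) : Primrec fun x => tup [f x, g x, h x, k x] :=
  primrec_tup.comp (Primrec.list_cons.comp hf (Primrec.list_cons.comp hg
    (Primrec.list_cons.comp hh (Primrec.list_cons.comp hk (Primrec.const [])))))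

theorem primrec_tup_five {f g h k l : α → ℕ} (hf : Primrec f) (hg : Primrec g) (hh : Primrec h)
    (hk : Primrec k) (hl : Primrec l) : Primrec fun x => tup [f x, g x, h x, k x, l x] :=
  primrec_tup.comp (Primrec.list_cons.comp hf (Primrec.list_cons.comp hg
    (Primrec.list_cons.comp hh (Primrec.list_cons.comp hk
      (Primrec.list_cons.comp hl (Primrec.const []))))))

theorem primrec_proj {f : α → ℕ} (hf : Primrec f) (i : ℕ) : Primrec fun x => proj (f x) i :=
  primrec₂_proj.comp hf (Primrec.const i)

theorem primrecPred_proj_eq {f : α → ℕ} (hf : Primrec f) (i k : ℕ) :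
    PrimrecPred fun x => proj (f x) i = k :=
  Primrec.eq.comp (primrec_proj hf i) (Primrec.const k)

theorem primrec_insCode_const {f : α → ℕ} (k : ℕ) (hf : Primrec f) :
    Primrec fun x => insCode k (f x) :=
  primrec₂_insCode.comp (Primrec.const k) hf

theorem primrec_delayCode {f g : α → ℕ} (hf : Primrec f) (hg : Primrec g) :
    Primrec fun x => delayCode (f x) (g x) :=
  primrec_tup_five (Primrec.const _) hg (Primrec.const _)
    (primrec_tup_four (Primrec.const _) hg (Primrec.const _) hf)
    (primrec_tup_four (Primrec.const _) hg (Primrec.const _)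
      (primrec_tup_two (Primrec.const _) (primrec_insCode_const _ hg)))

theorem primrec_endCode : Primrec endCode :=
  Primrec.ite ((primrecPred_proj_eq Primrec.id 0 _).or
      ((primrecPred_proj_eq Primrec.id 0 _).or (primrecPred_proj_eq Primrec.id 0 _)))
    (primrec_proj Primrec.id 1)
    (primrec₂_insCode.comp (primrec_proj Primrec.id 2) (primrec_proj Primrec.id 1))

theorem primrec_premiseCode {q : α → Code} {v : α → ℕ} (hq : Primrec q) (i : ℕ)
    (hv : Primrec v) : Primrec fun x => premiseCode (q x) i (v x) :=
  primrec_delayCode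
    (Primrec.encode.comp (Code.primrec₂_comp.comp hq (Primrec.const (Code.const i))))
    (primrec_insCode_const _ (primrec_endCode.comp hv))

theorem primrec_nodeCode {q : α → Code} {v v₀ v₁ : α → ℕ} (hq : Primrec q) (hv : Primrec v)
    (hv₀ : Primrec v₀) (hv₁ : Primrec v₁) :
    Primrec fun x => nodeCode (q x) (v x) (v₀ x) (v₁ x) := by
  have hΓ := primrec_insCode_const (encF falsum) (primrec_proj hv 1)
  have h₀ := primrec_premiseCode hq 0 hv₀
  have h₁ := primrec_premiseCode hq 1 hv₁
  exact Primrec.ite (primrecPred_proj_eq hv 0 _) (primrec_tup_two (Primrec.const _) hΓ)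
    (Primrec.ite (primrecPred_proj_eq hv 0 _)
      (primrec_tup_four (Primrec.const _) hΓ (primrec_proj hv 2) (Primrec.encode.comp hq))
      (Primrec.ite ((primrecPred_proj_eq hv 0 _).or (primrecPred_proj_eq hv 0 _))
        (primrec_tup_five (primrec_proj hv 0) hΓ (primrec_proj hv 2) h₀ h₁)
        (primrec_tup_four (primrec_proj hv 0) hΓ (primrec_proj hv 2) h₀)))

theorem partrec₂_peval : Partrec₂ peval :=
  Code.eval_part.comp ((Computable.ofNat Code).comp Computable.fst) Computable.snd

theorem partrec_subproofCode {c : α → Code} {a τ : α → ℕ} (hc : Primrec c) (ha : Primrec a)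
    (hτ : Primrec τ) : Partrec fun x => subproofCode (c x) (a x) (τ x) := by
  have hchild : ∀ i, Primrec fun x => snoc (τ x) i := fun i =>
    primrec₂_snoc.comp hτ (Primrec.const i)
  refine (partrec₂_peval.comp ha.to_comp hτ.to_comp).bind ?_
  refine (partrec₂_peval.comp (ha.comp Primrec.fst).to_comp
    ((hchild 0).comp Primrec.fst).to_comp).bind ?_
  have hx : Primrec fun y : (α × ℕ) × ℕ => y.1.1 := Primrec.fst.comp Primrec.fst
  refine (partrec₂_peval.comp (ha.comp hx).to_comp ((hchild 1).comp hx).to_comp).map ?_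
  have hz : Primrec fun z : ((α × ℕ) × ℕ) × ℕ => z.1.1.1 := hx.comp Primrec.fst
  exact (primrec_nodeCode
    (Code.primrec₂_curry.comp (hc.comp hz) (Primrec₂.natPair.comp (ha.comp hz) (hτ.comp hz)))
    ((Primrec.snd.comp Primrec.fst).comp Primrec.fst) (Primrec.snd.comp Primrec.fst)
    Primrec.snd).to_comp

end Primrec

theorem exists_subproofCode_program : ∃ c : Code, ∀ a σ n,
    c.eval (Nat.pair (Nat.pair a σ) n) = subproofCode c a (snoc σ n) := by
  have h₁ : Primrec fun x : Code × ℕ => x.2.unpair.1 :=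
    Primrec.fst.comp (Primrec.unpair.comp Primrec.snd)
  have h₂ : Primrec fun x : Code × ℕ => x.2.unpair.2 :=
    Primrec.snd.comp (Primrec.unpair.comp Primrec.snd)
  obtain ⟨c, hc⟩ := Code.fixed_point₂ (f := fun c x =>
      subproofCode c x.unpair.1.unpair.1 (snoc x.unpair.1.unpair.2 x.unpair.2))
    (partrec_subproofCode Primrec.fst (Primrec.fst.comp (Primrec.unpair.comp h₁))
      (primrec₂_snoc.comp (Primrec.snd.comp (Primrec.unpair.comp h₁)) h₂))
  exact ⟨c, fun a σ n => by simp [hc]⟩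

/-! ### Correctness of the translation -/

theorem LocallyCorrect.endCode_eq {f : ℕ → ℕ} (hf : LocallyCorrect f) {τ : ℕ}
    (hτ : TreeOf f τ) : endCode (f τ) = encS (EndS (f τ)) := by
  have main : ∀ {R : ℕ}, (R ≠ cutC ∧ R ≠ axC ∧ R ≠ omrepC) → ∀ (Γ : Finset Sentence)
      (A : Sentence), f τ = tup [R, encS Γ, encF A] → endCode (f τ) = encS (EndS (f τ)) := by
    intro R hR Γ A h
    rw [h, EndS_tup hR]
    simp [endCode, hR, insCode_encF_encS]
  by_cases h₀ : TreeOf f (snoc τ 0)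
  · rcases hf.inner τ hτ h₀ with ⟨Γ, A, B, h, -⟩ | ⟨Γ, A, B, h, -⟩ | ⟨Γ, A, hA, h, -⟩ |
      ⟨Γ, A, hA, n, h, -⟩ | ⟨Γ, C, h, -⟩
    · exact main (by decide) _ _ h
    · exact main (by decide) _ _ h
    · exact main (by decide) _ _ h
    · exact main (by decide) _ _ h
    · rw [h, EndS_tup_cutC]
      simp [endCode]
  · obtain ⟨Γ, -, h⟩ := hf.top τ hτ h₀
    rw [h, EndS_tup_axC]
    simp [endCode]

/-- A property of nodes of a well founded tree which is inherited from the children holds at the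
root. -/
theorem WFTree.induction {f : ℕ → ℕ} (hf : WFTree f) {P : ℕ → Prop}
    (step : ∀ l, TreeOf f (tup l) → (∀ n, TreeOf f (tup (l ++ [n])) → P (tup (l ++ [n]))) →
      P (tup l)) (root : TreeOf f rootSeq) : P rootSeq := by
  by_contra hP
  have next : ∀ l, ∃ n, TreeOf f (tup l) → ¬ P (tup l) →
      TreeOf f (tup (l ++ [n])) ∧ ¬ P (tup (l ++ [n])) := by
    intro l
    by_contra! h
    exact (h 0).2.1 (step l (h 0).1 fun n hn => (h n).2.2 hn)
  choose i hi using next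
  let L : ℕ → List ℕ := fun n => Nat.rec [] (fun _ l => l ++ [i l]) n
  have hL : ∀ n, L n = (List.range n).map fun n => i (L n) := by
    intro n
    induction n with
    | zero => rfl
    | succ n ih =>
      rw [List.range_succ, List.map_append, ← ih]
      rfl
  have hbad : ∀ n, TreeOf f (tup (L n)) ∧ ¬ P (tup (L n)) := by
    intro n
    induction n with
    | zero => exact ⟨root, hP⟩
    | succ n ih => exact hi (L n) ih.1 ih.2
  exact hf ⟨fun n => i (L n), fun n => hL n ▸ (hbad n).1⟩

section Correctness

variable {f g : ℕ → ℕ} {τ : ℕ} {q : Code}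

theorem cprec_premiseCode (hf : LocallyCorrect f)
    (hq : ∀ n, q.eval n = Part.some (g (snoc τ n))) {i : ℕ} (hi : TreeOf f (snoc τ i))
    (hg : Cprec (g (snoc τ i)))
    (hend : EndS (g (snoc τ i)) = EndS (f (snoc τ i)) ∪ {falsum}) :
    Cprec (premiseCode q i (f (snoc τ i))) ∧
      EndS (premiseCode q i (f (snoc τ i))) = EndS (f (snoc τ i)) ∪ {falsum} := by
  rw [premiseCode, hf.endCode_eq hi, insCode_encF_encS]
  refine ⟨cprec_delayCode (b := g (snoc τ i)) (fun n => ?_) (by simp) hg hend,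
    EndS_delayCode _ _⟩
  simp only [peval, Denumerable.ofNat_encode, Code.eval, Code.eval_const]
  exact (Part.bind_some _ _).trans (hq i)

theorem cprec_nodeCode (hf : LocallyCorrect f) (hprim : Nat.Primrec fun n => g (snoc τ n))
    (hq : ∀ n, q.eval n = Part.some (g (snoc τ n))) (hτ : TreeOf f τ)
    (ih : ∀ n, TreeOf f (snoc τ n) →
      Cprec (g (snoc τ n)) ∧ EndS (g (snoc τ n)) = EndS (f (snoc τ n)) ∪ {falsum}) :
    Cprec (nodeCode q (f τ) (f (snoc τ 0)) (f (snoc τ 1))) ∧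
      EndS (nodeCode q (f τ) (f (snoc τ 0)) (f (snoc τ 1))) = EndS (f τ) ∪ {falsum} := by
  have premise : ∀ i, TreeOf f (snoc τ i) → _ := fun i hi =>
    cprec_premiseCode hf hq hi (ih i hi).1 (ih i hi).2
  by_cases h₀ : TreeOf f (snoc τ 0)
  · rcases hf.inner τ hτ h₀ with ⟨Γ, A, B, h, -, h₁, -, e₀, e₁⟩ | ⟨Γ, A, B, h, -, -, e₀⟩ |
      ⟨Γ, A, hA, h, hc, e⟩ | ⟨Γ, A, hA, n, h, -, -, e₀⟩ | ⟨Γ, C, h, -, h₁, -, e₀, e₁⟩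
    · have hcode : nodeCode q (f τ) (f (snoc τ 0)) (f (snoc τ 1)) =
          tup [andC, encS (Γ ∪ {falsum}), encF (sAnd A B), premiseCode q 0 (f (snoc τ 0)),
            premiseCode q 1 (f (snoc τ 1))] := by
        simp [nodeCode, h, andC, axC, omC, insCode_encF_encS]
      obtain ⟨p₀, p₀'⟩ := premise 0 h₀
      obtain ⟨p₁, p₁'⟩ := premise 1 h₁
      rw [hcode, h, EndS_tup (by decide), EndS_tup (by decide)]
      refine ⟨CGen.and _ A B p₀ p₁ ?_ ?_, Finset.union_right_comm _ _ _⟩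
      · rw [p₀', e₀, Finset.union_right_comm]
      · rw [p₁', e₁, Finset.union_right_comm]
    · have hcode : nodeCode q (f τ) (f (snoc τ 0)) (f (snoc τ 1)) =
          tup [orC, encS (Γ ∪ {falsum}), encF (sOr A B), premiseCode q 0 (f (snoc τ 0))] := by
        simp [nodeCode, h, orC, andC, cutC, axC, omC, insCode_encF_encS]
      obtain ⟨p₀, p₀'⟩ := premise 0 h₀
      rw [hcode, h, EndS_tup (by decide), EndS_tup (by decide)]
      refine ⟨CGen.or _ A B p₀ ?_, Finset.union_right_comm _ _ _⟩
      rw [p₀', e₀, Finset.union_right_comm]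
    · have hcode : nodeCode q (f τ) (f (snoc τ 0)) (f (snoc τ 1)) =
          tup [omC, encS (Γ ∪ {falsum}), encF (sAll A hA), Encodable.encode q] := by
        simp [nodeCode, h, axC, omC, insCode_encF_encS]
      rw [hcode, h, EndS_tup (by decide), EndS_tup (by decide)]
      refine ⟨CGen.om_of_primrec hprim (fun n => ?_) _ A hA (fun n => (ih n (hc n)).1)
        fun n => ?_, Finset.union_right_comm _ _ _⟩
      · simp [peval, hq]
      · rw [(ih n (hc n)).2, e, Finset.union_right_comm]
    · have hcode : nodeCode q (f τ) (f (snoc τ 0)) (f (snoc τ 1)) =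
          tup [exC, encS (Γ ∪ {falsum}), encF (sEx A hA), premiseCode q 0 (f (snoc τ 0))] := by
        simp [nodeCode, h, exC, andC, cutC, axC, omC, insCode_encF_encS]
      obtain ⟨p₀, p₀'⟩ := premise 0 h₀
      rw [hcode, h, EndS_tup (by decide), EndS_tup (by decide)]
      refine ⟨CGen.ex _ A hA n p₀ ?_, Finset.union_right_comm _ _ _⟩
      rw [p₀', e₀, Finset.union_right_comm]
    · have hcode : nodeCode q (f τ) (f (snoc τ 0)) (f (snoc τ 1)) =
          tup [cutC, encS (Γ ∪ {falsum}), encF C, premiseCode q 0 (f (snoc τ 0)),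
            premiseCode q 1 (f (snoc τ 1))] := by
        simp [nodeCode, h, cutC, axC, omC, insCode_encF_encS]
      obtain ⟨p₀, p₀'⟩ := premise 0 h₀
      obtain ⟨p₁, p₁'⟩ := premise 1 h₁
      rw [hcode, h, EndS_tup_cutC, EndS_tup_cutC]
      refine ⟨CGen.cut rfl _ C p₀ p₁ ?_ ?_, rfl⟩
      · rw [p₀', e₀, Finset.union_right_comm]
      · rw [p₁', e₁, Finset.union_right_comm]
  · obtain ⟨Γ, ⟨A, hA, hA'⟩, h⟩ := hf.top τ hτ h₀
    have hcode : nodeCode q (f τ) (f (snoc τ 0)) (f (snoc τ 1)) =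
        tup [axC, encS (Γ ∪ {falsum})] := by
      simp [nodeCode, h, insCode_encF_encS]
    rw [hcode, h, EndS_tup_axC, EndS_tup_axC]
    exact ⟨CGen.ax _ ⟨A, Finset.mem_union_left _ hA, hA'⟩, rfl⟩

end Correctness

/-- Cut away the sentence `0 = 1` which `subproofCode` adds to the end sequent, where `b` is the
local code of the proof and `g` is the Gödel number of the sequent to be proved. -/
def cutFalsumCode (b g : ℕ) : ℕ :=
  tup [cutC, g, encF falsum, b, tup [axC, insCode (encF (sNeg falsum)) g]]

theorem primrec₂_cutFalsumCode : Primrec₂ cutFalsumCode :=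
  primrec_tup_five (Primrec.const _) Primrec.snd (Primrec.const _) Primrec.fst
    (primrec_tup_two (Primrec.const _) (primrec_insCode_const _ Primrec.snd))

theorem cprec_cutFalsumCode {b : ℕ} {Γ : Finset Sentence} (hb : Cprec b)
    (hend : EndS b = Γ ∪ {falsum}) : Cprec (cutFalsumCode b (encS Γ)) := by
  rw [cutFalsumCode, insCode_encF_encS]
  exact CGen.cut rfl Γ falsum hb (CGen.ax _ (isAxiom_union_neg_falsum Γ)) hend (EndS_tup_axC _)

/-- The number `0`, which labels the root of an empty tree, is read as the label of a node whose end
sequent contains `0 = 0`. -/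
theorem isAxiom_EndS_zero : IsAxiom (EndS 0) := by
  have hdec : decF 0 = ⟨.eq .zero .zero, rfl⟩ := rfl
  refine ⟨decF 0, ?_, ?_, ?_⟩
  · simp [EndS, proj, untup, cutC, axC, omrepC]
  · rw [hdec]
    rfl
  · rw [hdec]
    rfl

/-- **Primitive recursive indices to primitive recursive local codes.**
There is a partial recursive `φ` such that if `a ∈ I_prec` then `φ(a)` is
defined, `φ(a) ∈ C_prec`, and `End(⟨a⟩(⟨⟩)) = End(φ(a))`. -/
theorem prim_index_to_prim_code :
    ∃ φ : ℕ →. ℕ, Nat.Partrec φ ∧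
      ∀ (a : ℕ) (f : ℕ → ℕ), Nat.Primrec f → (∀ n, peval a n = Part.some (f n)) →
        IsOmegaProof f →
        ∃ b : ℕ, b ∈ φ a ∧ Cprec b ∧ EndS (f rootSeq) = EndS b := by
  obtain ⟨c, hc⟩ := exists_subproofCode_program
  refine ⟨fun a => (subproofCode c a rootSeq).bind fun b => (peval a rootSeq).map fun v =>
    if v = 0 then tup [axC, encS (EndS 0)] else cutFalsumCode b (endCode v), ?_, ?_⟩
  · refine Partrec.nat_iff.1 ?_
    refine (partrec_subproofCode (Primrec.const c) Primrec.id (Primrec.const rootSeq)).bind ?_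
    refine (partrec₂_peval.comp Computable.fst (Computable.const rootSeq)).map ?_
    exact (Primrec.ite (Primrec.eq.comp Primrec.snd (Primrec.const 0)) (Primrec.const _)
      (primrec₂_cutFalsumCode.comp (Primrec.snd.comp Primrec.fst)
        (primrec_endCode.comp Primrec.snd))).to_comp
  · intro a f hprim ha hf
    let g : ℕ → ℕ := fun τ =>
      nodeCode (c.curry (Nat.pair a τ)) (f τ) (f (snoc τ 0)) (f (snoc τ 1))
    have hg : ∀ τ, subproofCode c a τ = Part.some (g τ) := subproofCode_eq ha c
    have hgprim : Primrec g := by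
      have hf' : Primrec f := Primrec.nat_iff.2 hprim
      have hchild : ∀ i, Primrec fun τ => f (snoc τ i) := fun i =>
        hf'.comp (primrec₂_snoc.comp Primrec.id (Primrec.const i))
      exact primrec_nodeCode (Code.primrec₂_curry.comp (Primrec.const c)
        (Primrec₂.natPair.comp (Primrec.const a) Primrec.id)) hf' (hchild 0) (hchild 1)
    by_cases hzero : f rootSeq = 0
    · refine ⟨tup [axC, encS (EndS 0)], by simp [hg, ha, hzero],
        CGen.ax _ isAxiom_EndS_zero, ?_⟩
      rw [hzero, EndS_tup_axC]
    have hroot : TreeOf f rootSeq := ⟨Nat.succ_ne_zero _, hzero⟩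
    obtain ⟨hb, hend⟩ := hf.wf.induction
      (P := fun τ => Cprec (g τ) ∧ EndS (g τ) = EndS (f τ) ∪ {falsum}) (fun l hl ih => by
        refine cprec_nodeCode (g := g) hf.toLocallyCorrect ?_ (fun n => ?_) hl (by simpa using ih)
        · exact Primrec.nat_iff.1 (hgprim.comp (primrec₂_snoc.comp (Primrec.const _) Primrec.id))
        · rw [Code.eval_curry, hc, hg]) hroot
    refine ⟨cutFalsumCode (g rootSeq) (encS (EndS (f rootSeq))), ?_, cprec_cutFalsumCode hb hend,
      (EndS_tup_cutC _ _).symm⟩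
    simp [hg, ha, hzero, hf.endCode_eq hroot]

end Shoen
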